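/- Let G be an F_3-free split graph with split partition (K, I). If G contains an induced copy of the dart having exactly three of its vertices in K (forming a triangle T) and two of its vertices in I, then no vertex of I is adjacent to all three vertices of T. -/

import Mathlib

variable {V : Type*}

/-- `(K, I)` is a split partition of `G`: every vertex is in `K` or `I`, the sets are
disjoint, `K` is a clique and `I` is an independent set. -/
def IsSplitPartition (G : SimpleGraph V) (K I : Set V) : Prop :=
  (∀ v, v ∈ K ∨ v ∈ I) ∧ Disjoint K I ∧
  (∀ u ∈ K, ∀ v ∈ K, u ≠ v → G.Adj u v) ∧
  (∀ u ∈ I, ∀ v ∈ I, ¬ G.Adj u v)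

/-- `G` is `H`-free: there is no induced-subgraph embedding of `H` into `G`,
i.e. no induced subgraph of `G` is isomorphic to `H`. -/
def HFree {W : Type*} (G : SimpleGraph V) (H : SimpleGraph W) : Prop :=
  IsEmpty (H ↪g G)

/-- The bull: vertices a,b,c,d,e = 0,1,2,3,4 with edges ab, bc, ca, ad, be. -/
def bull : SimpleGraph (Fin 5) :=
  SimpleGraph.fromRel (fun u v =>
    (u, v) ∈ ([(0,1),(1,2),(2,0),(0,3),(1,4)] : List (Fin 5 × Fin 5)))

/-- The dart: vertices a,b,c,d,e = 0,1,2,3,4 with edges ab, bc, ca, ad, be, bd. -/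
def dart : SimpleGraph (Fin 5) :=
  SimpleGraph.fromRel (fun u v =>
    (u, v) ∈ ([(0,1),(1,2),(2,0),(0,3),(1,4),(1,3)] : List (Fin 5 × Fin 5)))

/-- `F₁`: a `K₄` on vertices a,b,c,d = 0,1,2,3, a vertex e = 4 adjacent only to a,
and a vertex f = 5 adjacent only to d. -/
def F1 : SimpleGraph (Fin 6) :=
  SimpleGraph.fromRel (fun u v =>
    (u, v) ∈ ([(0,1),(0,2),(0,3),(1,2),(1,3),(2,3),(0,4),(3,5)] : List (Fin 6 × Fin 6)))

/-- `F₂`: a `K₄` on vertices a,b,c,d = 0,1,2,3, a vertex e = 4 adjacent only to a,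
and a vertex f = 5 adjacent only to c and d. -/
def F2 : SimpleGraph (Fin 6) :=
  SimpleGraph.fromRel (fun u v =>
    (u, v) ∈ ([(0,1),(0,2),(0,3),(1,2),(1,3),(2,3),(0,4),(2,5),(3,5)] : List (Fin 6 × Fin 6)))

/-- `F₃`: a `K₄` on vertices a,b,c,d = 0,1,2,3, a vertex z = 4 adjacent only to a and b,
and a vertex y = 5 adjacent only to b. -/
def F3 : SimpleGraph (Fin 6) :=
  SimpleGraph.fromRel (fun u v =>
    (u, v) ∈ ([(0,1),(0,2),(0,3),(1,2),(1,3),(2,3),(0,4),(1,4),(1,5)] : List (Fin 6 × Fin 6)))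

/-- `Q`: vertices j1,j2,j3,i1,i2,i3 = 0,1,2,3,4,5 with edges
j1j2, j1j3, j2j3, i1j1, i2j2, i3j2, i3j3. -/
def Qgraph : SimpleGraph (Fin 6) :=
  SimpleGraph.fromRel (fun u v =>
    (u, v) ∈ ([(0,1),(0,2),(1,2),(3,0),(4,1),(5,1),(5,2)] : List (Fin 6 × Fin 6)))

/-- `K_{1,3} + 2P₁`: a star with centre 0 and leaves 1,2,3, plus isolated vertices 4,5. -/
def K13_2P1 : SimpleGraph (Fin 6) :=
  SimpleGraph.fromRel (fun u v =>
    (u, v) ∈ ([(0,1),(0,2),(0,3)] : List (Fin 6 × Fin 6)))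

/-- A module of `G`: every vertex outside `M` is adjacent to all of `M` or to none of it. -/
def IsModule (G : SimpleGraph V) (M : Set V) : Prop :=
  ∀ v ∉ M, (∀ u ∈ M, G.Adj v u) ∨ (∀ u ∈ M, ¬ G.Adj v u)

/-- `G` is prime: every module of `G` is trivial (has at most one vertex,
or is the whole vertex set). -/
def IsPrime (G : SimpleGraph V) : Prop :=
  ∀ M : Set V, IsModule G M → M.Subsingleton ∨ M = Set.univ

instance : DecidableRel dart.Adj := fun _ _ =>
  inferInstanceAs (Decidable (_ ≠ _ ∧ (_ ∨ _)))

instance : DecidableRel F3.Adj := fun _ _ =>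
  inferInstanceAs (Decidable (_ ≠ _ ∧ (_ ∨ _)))

/-- Distinct vertices of `F₃` are adjacent or are separated by a neighbour of exactly one of them,
so a map that preserves and reflects adjacency is injective. -/
theorem F3_eq_or_adj_or_separated (u v : Fin 6) :
    u = v ∨ F3.Adj u v ∨ ∃ w, ¬ (F3.Adj u w ↔ F3.Adj v w) := by
  revert u v
  decide

theorem HFree.F3_false_of_adj_iff {G : SimpleGraph V} (hfree : HFree G F3) (g : Fin 6 → V)
    (hg : ∀ u v, G.Adj (g u) (g v) ↔ F3.Adj u v) : False := by
  refine hfree.false ⟨⟨g, fun u v huv => ?_⟩, fun {u v} => hg u v⟩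
  rcases F3_eq_or_adj_or_separated u v with h | h | ⟨w, h⟩
  · exact h
  · exact absurd ((hg u v).2 h) (huv ▸ G.irrefl)
  · exact absurd (by rw [← hg, ← hg, huv]) h

/-- In an `F₃`-free graph, a triangle `a, b, c` with pairwise nonadjacent `x`, `y`, `z` outside it
cannot have `x` complete to the triangle, `z` adjacent to just `a, b` and `y` to just `b`. -/
theorem HFree.F3_false_of_adj {G : SimpleGraph V} (hfree : HFree G F3) {a b c x y z : V}
    (hab : G.Adj a b) (hac : G.Adj a c) (hbc : G.Adj b c)
    (hxa : G.Adj x a) (hxb : G.Adj x b) (hxc : G.Adj x c)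
    (hza : G.Adj z a) (hzb : G.Adj z b) (hzc : ¬ G.Adj z c)
    (hya : ¬ G.Adj y a) (hyb : G.Adj y b) (hyc : ¬ G.Adj y c)
    (hxz : ¬ G.Adj x z) (hxy : ¬ G.Adj x y) (hzy : ¬ G.Adj z y) : False := by
  refine hfree.F3_false_of_adj_iff ![a, b, c, x, z, y] fun u v => ?_
  fin_cases u <;> fin_cases v <;>
    simp [F3, *, hab.symm, hac.symm, hbc.symm, hxa.symm, hxb.symm, hxc.symm, hza.symm, hzb.symm,
      hyb.symm, G.adj_comm a y, G.adj_comm c y, G.adj_comm c z, G.adj_comm z x, G.adj_comm y x,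
      G.adj_comm y z]

/-- The triangles of the dart are `{0, 1, 2}` and `{0, 1, 3}`. -/
theorem dart_triangle_cases (T : Finset (Fin 5)) (hT : T.card = 3)
    (htri : ∀ u ∈ T, ∀ v ∈ T, u ≠ v → dart.Adj u v) :
    T = {0, 1, 2} ∨ T = {0, 1, 3} := by
  revert T
  decide

/-- Let `G` be an `F₃`-free split graph with split partition `(K, I)`. If `G` contains an
induced copy of the dart (via an embedding `f`) having exactly three of its vertices in `K`,
forming a triangle `T`, and two of its vertices in `I`, then no vertex of `I` is adjacent to
all three vertices of (the image of) `T`. -/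
theorem F3_free_special_dart_no_full_neighbour (G : SimpleGraph V) (K I : Set V)
    (h : IsSplitPartition G K I) (hfree : HFree G F3)
    (f : dart ↪g G) (T : Finset (Fin 5)) (hT : T.card = 3)
    (htri : ∀ u ∈ T, ∀ v ∈ T, u ≠ v → dart.Adj u v)
    (hTK : ∀ v ∈ T, f v ∈ K) (hTI : ∀ v ∉ T, f v ∈ I) :
    ∀ x ∈ I, ¬ ∀ v ∈ T, G.Adj x (f v) := by
  intro x hx hxT
  obtain ⟨-, -, -, hI⟩ := h
  have key : ∀ u v, dart.Adj u v → G.Adj (f u) (f v) := fun u v => f.map_adj_iff.2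
  have nkey : ∀ u v, ¬ dart.Adj u v → ¬ G.Adj (f u) (f v) := fun u v => mt f.map_adj_iff.1
  have hnx : ∀ v ∉ T, ¬ G.Adj x (f v) := fun v hv => hI x hx _ (hTI v hv)
  rcases dart_triangle_cases T hT htri with rfl | rfl
  · exact hfree.F3_false_of_adj (a := f 0) (b := f 1) (c := f 2) (x := x) (y := f 4) (z := f 3)
      (key _ _ (by decide)) (key _ _ (by decide)) (key _ _ (by decide))
      (hxT _ (by decide)) (hxT _ (by decide)) (hxT _ (by decide))
      (key _ _ (by decide)) (key _ _ (by decide)) (nkey _ _ (by decide))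
      (nkey _ _ (by decide)) (key _ _ (by decide)) (nkey _ _ (by decide))
      (hnx _ (by decide)) (hnx _ (by decide)) (nkey _ _ (by decide))
  · exact hfree.F3_false_of_adj (a := f 0) (b := f 1) (c := f 3) (x := x) (y := f 4) (z := f 2)
      (key _ _ (by decide)) (key _ _ (by decide)) (key _ _ (by decide))
      (hxT _ (by decide)) (hxT _ (by decide)) (hxT _ (by decide))
      (key _ _ (by decide)) (key _ _ (by decide)) (nkey _ _ (by decide))
      (nkey _ _ (by decide)) (key _ _ (by decide)) (nkey _ _ (by decide))
      (hnx _ (by decide)) (hnx _ (by decide)) (nkey _ _ (by decide))
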